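/- (Hadwiger) Let V be an n-dimensional real vector space and let φ : 𝒦(V) → ℝ be a continuous, translation invariant valuation which is homogeneous of degree n (φ(tK) = tⁿφ(K) for all t ≥ 0). Then there is a constant c ∈ ℝ with φ(K) = c·vol_n(K) for all K ∈ 𝒦(V). -/

import Mathlib

open scoped Pointwise
open MeasureTheory Module

noncomputable section

section CommonDefs

variable {V V' A : Type*}
variable [NormedAddCommGroup V] [NormedSpace ℝ V]
variable [NormedAddCommGroup V'] [NormedSpace ℝ V']
variable [NormedAddCommGroup A] [NormedSpace ℝ A]

/-- The supremum of a (pairing) functional over a convex body; used to express the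
support function `h(K, ξ) = sup_{x ∈ K} ⟨ξ, x⟩` for the various pairings `p = ⟨ξ, ·⟩`. -/
def hSupp (K : ConvexBody V) (p : V → ℝ) : ℝ := sSup (p '' (K : Set V))

/-- The translate `x + K` of a convex body. -/
def ConvexBody.translate (K : ConvexBody V) (x : V) : ConvexBody V :=
  ⟨(fun y => x + y) '' (K : Set V), K.convex.translate x,
    K.isCompact.image (continuous_const.add continuous_id),
    K.nonempty.image _⟩

/-- The image of a convex body under a continuous linear map. -/
def ConvexBody.mapCLM (f : V →L[ℝ] V') (K : ConvexBody V) : ConvexBody V' :=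
  ⟨f '' (K : Set V), K.convex.linear_image (f : V →ₗ[ℝ] V'),
    K.isCompact.image f.continuous, K.nonempty.image _⟩

/-- The reflection `-K` of a convex body about the origin. -/
def ConvexBody.neg (K : ConvexBody V) : ConvexBody V :=
  K.mapCLM (-(ContinuousLinearMap.id ℝ V))

/-- The union of two convex bodies (a convex body provided it is convex). -/
def ConvexBody.union (K L : ConvexBody V) (h : Convex ℝ ((K : Set V) ∪ (L : Set V))) :
    ConvexBody V :=
  ⟨(K : Set V) ∪ (L : Set V), h, K.isCompact.union L.isCompact,
    K.nonempty.mono Set.subset_union_left⟩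

/-- The intersection of two convex bodies (a convex body provided it is nonempty). -/
def ConvexBody.inter (K L : ConvexBody V) (h : ((K : Set V) ∩ (L : Set V)).Nonempty) :
    ConvexBody V :=
  ⟨(K : Set V) ∩ (L : Set V), K.convex.inter L.convex,
    K.isCompact.inter_right L.isClosed, h⟩

/-- A Minkowski valuation: `Z(K ∪ L) + Z(K ∩ L) = Z(K) + Z(L)` (Minkowski addition)
whenever `K, L, K ∪ L` are convex bodies. -/
def IsMinkowskiValuation (Z : ConvexBody V → ConvexBody A) : Prop :=
  ∀ (K L : ConvexBody V) (hU : Convex ℝ ((K : Set V) ∪ (L : Set V)))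
    (hI : ((K : Set V) ∩ (L : Set V)).Nonempty),
    Z (K.union L hU) + Z (K.inter L hI) = Z K + Z L

/-- A real-valued valuation: `φ(K ∪ L) + φ(K ∩ L) = φ(K) + φ(L)`
whenever `K, L, K ∪ L` are convex bodies. -/
def IsValuation (φ : ConvexBody V → ℝ) : Prop :=
  ∀ (K L : ConvexBody V) (hU : Convex ℝ ((K : Set V) ∪ (L : Set V)))
    (hI : ((K : Set V) ∩ (L : Set V)).Nonempty),
    φ (K.union L hU) + φ (K.inter L hI) = φ K + φ L

/-- Translation invariance of a map defined on convex bodies. -/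
def IsTranslationInvariant {α : Type*} (Z : ConvexBody V → α) : Prop :=
  ∀ (K : ConvexBody V) (x : V), Z (K.translate x) = Z K

/-- The mixed volume (w.r.t. the Lebesgue (Haar) measure `μ`) of an `n`-tuple of convex
bodies, given by the polarization formula
`V(K₁, …, Kₙ) = (1/n!) ∑_{S ⊆ {1,…,n}} (-1)^{n - |S|} vol(∑_{i ∈ S} K_i)`. -/
def mixedVol [MeasurableSpace V] (μ : Measure V) {n : ℕ} (K : Fin n → ConvexBody V) : ℝ :=
  (n.factorial : ℝ)⁻¹ *
    ∑ S : Finset (Fin n), (-1 : ℝ) ^ (n - S.card) * (μ (∑ i ∈ S, (K i : Set V))).toReal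

/-- The extension `V(K, …, K, f)` (with `n - 1` copies of `K`) of the mixed volume to
continuous positively `1`-homogeneous functions `f` on the dual space, defined via
Aleksandrov's variational formula: `V(K,…,K,f)` is `1/n` times the right derivative at
`t = 0` of the volume of the Wulff shape (aka Aleksandrov body) of `h_K + t f`.
For `f = h_L` the Wulff shape is `K + t L`, so this indeed extends `L ↦ V(K, …, K, L)`. -/
def mixedVolFn [MeasurableSpace V] (μ : Measure V) (K : ConvexBody V)
    (f : (V →L[ℝ] ℝ) → ℝ) : ℝ :=
  (Module.finrank ℝ V : ℝ)⁻¹ *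
    derivWithin (fun t : ℝ =>
        (μ {x : V | ∀ ξ : V →L[ℝ] ℝ, ξ x ≤ hSupp K ξ + t * f ξ}).toReal)
      (Set.Ici 0) 0

/-- The dimension of a convex body: the dimension of (the direction of) its affine hull. -/
def bodyDim (K : ConvexBody V) : ℕ := Module.finrank ℝ (vectorSpan ℝ (K : Set V))

/-- A convex body contained in a subspace `E`, viewed as a convex body of `E`. -/
def bodyIn (E : Submodule ℝ V) (K : ConvexBody V) (h : (K : Set V) ⊆ (E : Set V)) :
    ConvexBody ↥E :=
  ⟨Subtype.val ⁻¹' (K : Set V),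
    K.convex.linear_preimage (E.subtype),
    by
      rw [Topology.IsEmbedding.subtypeVal.isCompact_iff,
        Set.image_preimage_eq_of_subset (by rw [Subtype.range_coe]; exact h)]
      exact K.isCompact,
    by obtain ⟨x, hx⟩ := K.nonempty; exact ⟨⟨x, h hx⟩, hx⟩⟩

/-- The properties of the components of McMullen's decomposition of (the support function
of) a Minkowski valuation: each `fᵢ(·, u)` is a continuous, translation invariant
valuation, homogeneous of degree `i`, and each `fᵢ(K, ·)` is continuous and positively
`1`-homogeneous. -/
def McMullenProps (f : ℕ → ConvexBody V → V → ℝ) : Prop :=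
  (∀ (i : ℕ) (u : V), Continuous fun K : ConvexBody V => f i K u) ∧
  (∀ (i : ℕ) (u : V), IsValuation fun K : ConvexBody V => f i K u) ∧
  (∀ (i : ℕ) (u : V), IsTranslationInvariant fun K : ConvexBody V => f i K u) ∧
  (∀ (i : ℕ) (K : ConvexBody V) (u : V) (t : ℝ), 0 < t → f i (t • K) u = t ^ i * f i K u) ∧
  (∀ (i : ℕ) (K : ConvexBody V), Continuous fun u : V => f i K u) ∧
  (∀ (i : ℕ) (K : ConvexBody V) (u : V) (t : ℝ), 0 < t → f i K (t • u) = t * f i K u)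

end CommonDefs

/-- The surface area measure `S(M, ·)` on `S¹ ⊆ ℂ` of a planar convex body `M`,
characterized (uniquely) by the property that it is a finite measure concentrated on the
unit circle with `∫_{S¹} h(L, α) dσ(α) = 2 V(M, L)` for every planar convex body `L`. -/
def IsSurfaceAreaMeasure (M : ConvexBody ℂ) (σ : Measure ℂ) : Prop :=
  IsFiniteMeasure σ ∧ σ (Metric.sphere (0 : ℂ) 1)ᶜ = 0 ∧
    ∀ L : ConvexBody ℂ,
      (∫ α, hSupp L (fun c => (c * (starRingEnd ℂ) α).re) ∂σ) = 2 * mixedVol volume ![M, L]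

/-! ### Compactness of the space of convex bodies in a compact set -/

/-- A convex body, viewed as a nonempty compact set. -/
def ConvexBody.toNonemptyCompacts {V : Type*} [NormedAddCommGroup V] [NormedSpace ℝ V]
    (K : ConvexBody V) : TopologicalSpace.NonemptyCompacts V :=
  ⟨⟨K, K.isCompact⟩, K.nonempty⟩

section Blaschke

variable {V : Type*} [NormedAddCommGroup V] [NormedSpace ℝ V]

open TopologicalSpace

theorem isClosed_setOf_convex_nonemptyCompacts :
    IsClosed {L : NonemptyCompacts V | Convex ℝ (L : Set V)} := by
  have hf (a b : ℝ) : Continuous fun p : V × V => a • p.1 + b • p.2 := by fun_prop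
  have h : {L : NonemptyCompacts V | Convex ℝ (L : Set V)} =
      ⋂ (a : ℝ) (b : ℝ) (_ : 0 ≤ a) (_ : 0 ≤ b) (_ : a + b = 1),
        {L | (L ×ˢ L).map _ (hf a b) ⊔ L = L} := by
    ext L
    simp only [Set.mem_iInter, Set.mem_ofPred_eq]
    have key (a b : ℝ) : (L ×ˢ L).map _ (hf a b) ⊔ L = L ↔
        ∀ x ∈ (L : Set V), ∀ y ∈ (L : Set V), a • x + b • y ∈ (L : Set V) := by
      rw [← SetLike.coe_set_eq]
      simp only [NonemptyCompacts.coe_sup, NonemptyCompacts.coe_map, NonemptyCompacts.coe_prod,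
        Set.union_eq_right, Set.image_subset_iff]
      exact ⟨fun h x hx y hy => h (a := (x, y)) ⟨hx, hy⟩, fun h p hp => h _ hp.1 _ hp.2⟩
    simp only [key]
    exact ⟨fun h a b ha hb hab x hx y hy => h hx hy ha hb hab,
      fun h x hx y hy a b ha hb hab => h a b ha hb hab x hx y hy⟩
  rw [h]
  refine isClosed_iInter fun a => isClosed_iInter fun b => isClosed_iInter fun _ =>
    isClosed_iInter fun _ => isClosed_iInter fun _ => isClosed_eq ?_ continuous_id
  exact (((hf a b).nonemptyCompacts_map).comp
    (NonemptyCompacts.continuous_prod.comp (continuous_id.prodMk continuous_id))).sup continuous_id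

theorem ConvexBody.isometry_toNonemptyCompacts :
    Isometry (ConvexBody.toNonemptyCompacts : ConvexBody V → NonemptyCompacts V) :=
  Isometry.of_dist_eq fun _ _ => rfl

theorem ConvexBody.isClosedEmbedding_toNonemptyCompacts :
    Topology.IsClosedEmbedding
      (ConvexBody.toNonemptyCompacts : ConvexBody V → NonemptyCompacts V) := by
  refine ⟨ConvexBody.isometry_toNonemptyCompacts.isEmbedding, ?_⟩
  convert isClosed_setOf_convex_nonemptyCompacts (V := V) using 1
  ext L
  exact ⟨by rintro ⟨K, rfl⟩; exact K.convex,
    fun h => ⟨⟨L, h, L.isCompact, L.nonempty⟩, rfl⟩⟩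

/-- **Blaschke selection theorem**. -/
theorem ConvexBody.isCompact_setOf_subset {C : Set V} (hC : IsCompact C) :
    IsCompact {K : ConvexBody V | (K : Set V) ⊆ C} :=
  ConvexBody.isClosedEmbedding_toNonemptyCompacts.isCompact_preimage
    (NonemptyCompacts.isCompact_subsets_of_isCompact hC)

theorem ConvexBody.exists_abs_le_of_subset {φ : ConvexBody V → ℝ} (hφ : Continuous φ)
    {C : Set V} (hC : IsCompact C) :
    ∃ M, 0 ≤ M ∧ ∀ K : ConvexBody V, (K : Set V) ⊆ C → |φ K| ≤ M := by
  obtain ⟨M, hM⟩ := (ConvexBody.isCompact_setOf_subset hC).exists_bound_of_continuousOn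
    hφ.continuousOn
  exact ⟨max M 0, le_max_right _ _, fun K hK => (hM K hK).trans (le_max_left _ _)⟩

end Blaschke

/-! ### Cutting along the hyperplanes of a grid -/

section Grid

variable {V : Type*} [NormedAddCommGroup V] [NormedSpace ℝ V]

/-- A set function that vanishes on the empty set and is additive when a compact convex set
is cut by a hyperplane. -/
structure IsCutAdditive (ψ : Set V → ℝ) : Prop where
  empty : ψ ∅ = 0
  cut : ∀ (A : Set V), Convex ℝ A → IsCompact A → ∀ (f : V →L[ℝ] ℝ) (a : ℝ),
    ψ A + ψ (A ∩ {x | f x = a}) = ψ (A ∩ {x | f x ≤ a}) + ψ (A ∩ {x | a ≤ f x})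

/-- The value of `ψ` on the part of a set lying in the half-open slab `k ≤ f < k + 1`. -/
def slabPart (f : V →L[ℝ] ℝ) (k : ℤ) (ψ : Set V → ℝ) (A : Set V) : ℝ :=
  ψ (A ∩ {x | k ≤ f x ∧ f x ≤ k + 1}) - ψ (A ∩ {x | f x = k + 1})

/-- The value of `ψ` on the part of a set lying in the half-open cell with index `z`. -/
def cellPart : ∀ {n : ℕ}, (Fin n → V →L[ℝ] ℝ) → (Fin n → ℤ) → (Set V → ℝ) → Set V → ℝ
  | 0, _, _, ψ => ψ
  | _ + 1, ℓ, z, ψ => cellPart (Fin.tail ℓ) (Fin.tail z) (slabPart (ℓ 0) (z 0) ψ)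

/-- The closed cell with index `z`. -/
def gridCell {n : ℕ} (ℓ : Fin n → V →L[ℝ] ℝ) (z : Fin n → ℤ) : Set V :=
  {x | ∀ i, z i ≤ ℓ i x ∧ ℓ i x ≤ z i + 1}

/-- The half-open cell with index `z`. -/
def halfOpenCell {n : ℕ} (ℓ : Fin n → V →L[ℝ] ℝ) (z : Fin n → ℤ) : Set V :=
  {x | ∀ i, z i ≤ ℓ i x ∧ ℓ i x < z i + 1}

theorem halfOpenCell_subset_gridCell {n : ℕ} (ℓ : Fin n → V →L[ℝ] ℝ) (z : Fin n → ℤ) :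
    halfOpenCell ℓ z ⊆ gridCell ℓ z :=
  fun _ hx i => ⟨(hx i).1, (hx i).2.le⟩

theorem mem_halfOpenCell_iff {n : ℕ} {ℓ : Fin n → V →L[ℝ] ℝ} {z : Fin n → ℤ} {x : V} :
    x ∈ halfOpenCell ℓ z ↔ ∀ i, ⌊ℓ i x⌋ = z i := by
  simp only [halfOpenCell, Set.mem_ofPred_eq, Int.floor_eq_iff]

theorem pairwise_disjoint_halfOpenCell {n : ℕ} (ℓ : Fin n → V →L[ℝ] ℝ) :
    Pairwise (Function.onFun Disjoint (halfOpenCell ℓ)) := by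
  intro z w hzw
  refine Set.disjoint_left.2 fun x hx hy => hzw (funext fun i => ?_)
  rw [← mem_halfOpenCell_iff.1 hx i, mem_halfOpenCell_iff.1 hy i]

theorem convex_gridCell {n : ℕ} (ℓ : Fin n → V →L[ℝ] ℝ) (z : Fin n → ℤ) :
    Convex ℝ (gridCell ℓ z) := by
  have : gridCell ℓ z = ⋂ i, ℓ i ⁻¹' Set.Icc (z i : ℝ) (z i + 1) := by
    ext x; simp [gridCell]
  rw [this]
  exact convex_iInter fun i => (convex_Icc _ _).linear_preimage (ℓ i : V →ₗ[ℝ] ℝ)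

theorem measurableSet_halfOpenCell [MeasurableSpace V] [BorelSpace V] {n : ℕ}
    (ℓ : Fin n → V →L[ℝ] ℝ) (z : Fin n → ℤ) : MeasurableSet (halfOpenCell ℓ z) := by
  have : halfOpenCell ℓ z = ⋂ i, ℓ i ⁻¹' Set.Ico (z i : ℝ) (z i + 1) := by
    ext x; simp [halfOpenCell]
  rw [this]
  exact MeasurableSet.iInter fun i => (ℓ i).continuous.measurable measurableSet_Ico

theorem gridCell_tail_inter {n : ℕ} (ℓ : Fin (n + 1) → V →L[ℝ] ℝ) (z : Fin (n + 1) → ℤ) :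
    gridCell (Fin.tail ℓ) (Fin.tail z) ∩ {x | z 0 ≤ ℓ 0 x ∧ ℓ 0 x ≤ z 0 + 1} = gridCell ℓ z := by
  ext x
  simp only [gridCell, Fin.tail, Set.mem_inter_iff, Set.mem_ofPred_eq, Fin.forall_fin_succ]
  tauto

theorem IsCutAdditive.slabPart {ψ : Set V → ℝ} (hψ : IsCutAdditive ψ) (f : V →L[ℝ] ℝ) (k : ℤ) :
    IsCutAdditive (slabPart f k ψ) := by
  have hS : Convex ℝ {x | (k : ℝ) ≤ f x ∧ f x ≤ k + 1} :=
    (convex_Icc (k : ℝ) (k + 1)).linear_preimage (f : V →ₗ[ℝ] ℝ)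
  have hS' : IsClosed {x | (k : ℝ) ≤ f x ∧ f x ≤ k + 1} :=
    (isClosed_Icc (a := (k : ℝ)) (b := k + 1)).preimage f.continuous
  have hH : Convex ℝ {x | f x = k + 1} :=
    (convex_singleton ((k : ℝ) + 1)).linear_preimage (f : V →ₗ[ℝ] ℝ)
  have hH' : IsClosed {x | f x = k + 1} :=
    (isClosed_singleton (x := (k : ℝ) + 1)).preimage f.continuous
  refine ⟨by simp [_root_.slabPart, hψ.empty], fun A hA hA' g a => ?_⟩
  have h₁ := hψ.cut _ (hA.inter hS) (hA'.inter_right hS') g a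
  have h₂ := hψ.cut _ (hA.inter hH) (hA'.inter_right hH') g a
  simp only [_root_.slabPart, Set.inter_right_comm A {x | g x = a},
    Set.inter_right_comm A {x | g x ≤ a}, Set.inter_right_comm A {x | a ≤ g x}]
  linarith

theorem IsCutAdditive.sum_slabPart {ψ : Set V → ℝ} (hψ : IsCutAdditive ψ) (f : V →L[ℝ] ℝ)
    {A : Set V} (hA : Convex ℝ A) (hA' : IsCompact A) {a : ℤ} (N : ℕ)
    (hAf : ∀ x ∈ A, a ≤ f x ∧ f x < a + N) :
    ψ A = ∑ k ∈ Finset.Ico a (a + N), _root_.slabPart f k ψ A := by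
  have step (k : ℤ) : _root_.slabPart f k ψ A =
      ψ (A ∩ {x | (k : ℝ) ≤ f x}) - ψ (A ∩ {x | ((k + 1 : ℤ) : ℝ) ≤ f x}) := by
    have h := hψ.cut (A ∩ {x | (k : ℝ) ≤ f x})
      (hA.inter ((convex_Ici (k : ℝ)).linear_preimage (f : V →ₗ[ℝ] ℝ)))
      (hA'.inter_right ((isClosed_Ici (a := (k : ℝ))).preimage f.continuous)) f (k + 1)
    have h₁ : A ∩ {x | (k : ℝ) ≤ f x} ∩ {x | f x = k + 1} = A ∩ {x | f x = k + 1} := by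
      ext x; simp only [Set.mem_inter_iff, Set.mem_ofPred_eq]
      exact ⟨fun h => ⟨h.1.1, h.2⟩, fun h => ⟨⟨h.1, by linarith [h.2]⟩, h.2⟩⟩
    have h₂ : A ∩ {x | (k : ℝ) ≤ f x} ∩ {x | (k : ℝ) + 1 ≤ f x} =
        A ∩ {x | ((k + 1 : ℤ) : ℝ) ≤ f x} := by
      ext x; simp only [Set.mem_inter_iff, Set.mem_ofPred_eq]; push_cast
      exact ⟨fun h => ⟨h.1.1, h.2⟩, fun h => ⟨⟨h.1, by linarith [h.2]⟩, h.2⟩⟩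
    have h₃ : A ∩ {x | (k : ℝ) ≤ f x} ∩ {x | f x ≤ k + 1} =
        A ∩ {x | (k : ℝ) ≤ f x ∧ f x ≤ k + 1} := Set.inter_assoc _ _ _
    rw [h₁, h₂, h₃] at h
    rw [_root_.slabPart]
    linarith
  have tele : ∀ N : ℕ, ∑ k ∈ Finset.Ico a (a + N), _root_.slabPart f k ψ A =
      ψ (A ∩ {x | (a : ℝ) ≤ f x}) - ψ (A ∩ {x | ((a + N : ℤ) : ℝ) ≤ f x}) := by
    intro N
    induction N with
    | zero => simp
    | succ N ih =>
      have : Finset.Ico a (a + (N + 1 : ℕ)) = insert (a + N : ℤ) (Finset.Ico a (a + N)) := by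
        ext k; simp only [Finset.mem_Ico, Finset.mem_insert]; push_cast; lia
      rw [this, Finset.sum_insert (by simp), ih, step]
      push_cast
      rw [add_assoc (a : ℝ)]
      ring
  have h₁ : A ∩ {x | (a : ℝ) ≤ f x} = A := Set.inter_eq_left.2 fun x hx => (hAf x hx).1
  have h₂ : A ∩ {x | ((a + N : ℤ) : ℝ) ≤ f x} = ∅ := by
    refine Set.eq_empty_of_forall_notMem fun x hx => ?_
    have := (hAf x hx.1).2
    have h := hx.2
    simp only [Set.mem_ofPred_eq] at h
    push_cast at h
    linarith
  rw [tele, h₁, h₂, hψ.empty, sub_zero]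

theorem IsCutAdditive.sum_cellPart {n : ℕ} {ℓ : Fin n → V →L[ℝ] ℝ} {ψ : Set V → ℝ}
    (hψ : IsCutAdditive ψ) {A : Set V} (hA : Convex ℝ A) (hA' : IsCompact A) {a : ℤ} (N : ℕ)
    (hAf : ∀ i, ∀ x ∈ A, a ≤ ℓ i x ∧ ℓ i x < a + N) :
    ψ A = ∑ z ∈ Fintype.piFinset fun _ : Fin n => Finset.Ico a (a + N), cellPart ℓ z ψ A := by
  induction n generalizing ψ with
  | zero => simp [cellPart]
  | succ n ih =>
    rw [hψ.sum_slabPart (ℓ 0) hA hA' N (hAf 0)]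
    simp_rw [fun k => ih (ℓ := Fin.tail ℓ) (hψ.slabPart (ℓ 0) k) fun i => hAf i.succ]
    rw [← Finset.sum_product']
    refine Finset.sum_equiv (Fin.consEquiv fun _ => ℤ) ?_ ?_
    · rintro ⟨k, z⟩
      simp [Fin.forall_fin_succ, Fin.consEquiv]
    · rintro ⟨k, z⟩ -
      simp [cellPart, Fin.consEquiv]

theorem cellPart_congr {n : ℕ} {ℓ : Fin n → V →L[ℝ] ℝ} {z : Fin n → ℤ} {ψ : Set V → ℝ}
    {A A' : Set V} (h : ∀ B ⊆ gridCell ℓ z, ψ (A ∩ B) = ψ (A' ∩ B)) :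
    cellPart ℓ z ψ A = cellPart ℓ z ψ A' := by
  induction n generalizing ψ with
  | zero => simpa [gridCell, cellPart] using h Set.univ
  | succ n ih =>
    refine ih fun B hB => ?_
    rw [slabPart, slabPart, Set.inter_assoc, Set.inter_assoc, Set.inter_assoc, Set.inter_assoc,
      h, h]
    · rw [← gridCell_tail_inter]
      exact Set.inter_subset_inter hB fun x hx => by
        simp only [Set.mem_ofPred_eq] at hx ⊢; constructor <;> linarith
    · rw [← gridCell_tail_inter]
      exact Set.inter_subset_inter_left _ hB

theorem abs_cellPart_le {n : ℕ} {ℓ : Fin n → V →L[ℝ] ℝ} {z : Fin n → ℤ} {ψ : Set V → ℝ}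
    {A : Set V} {M : ℝ} (h : ∀ B ⊆ gridCell ℓ z, |ψ (A ∩ B)| ≤ M) :
    |cellPart ℓ z ψ A| ≤ 2 ^ n * M := by
  induction n generalizing ψ M with
  | zero => simpa [gridCell, cellPart] using h Set.univ
  | succ n ih =>
    rw [pow_succ, mul_assoc]
    refine ih fun B hB => ?_
    rw [slabPart, Set.inter_assoc, Set.inter_assoc, two_mul]
    refine (abs_sub _ _).trans (add_le_add (h _ ?_) (h _ ?_))
    · rw [← gridCell_tail_inter]
      exact Set.inter_subset_inter_left _ hB
    · rw [← gridCell_tail_inter]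
      exact Set.inter_subset_inter hB fun x hx => by
        simp only [Set.mem_ofPred_eq] at hx ⊢; constructor <;> linarith

theorem cellPart_translate {n : ℕ} {ℓ : Fin n → V →L[ℝ] ℝ} {z : Fin n → ℤ} {ψ χ : Set V → ℝ}
    {v : V} (hv : ∀ i, ℓ i v = z i) (h : ∀ A, ψ ((fun y => v + y) '' A) = χ A) (A : Set V) :
    cellPart ℓ z ψ ((fun y => v + y) '' A) = cellPart ℓ 0 χ A := by
  induction n generalizing ψ χ A with
  | zero => exact h A
  | succ n ih =>
    refine ih (ψ := slabPart (ℓ 0) (z 0) ψ) (χ := slabPart (ℓ 0) 0 χ)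
      (fun i => hv i.succ) (fun A => ?_) A
    rw [slabPart, slabPart, ← h, ← h, Set.image_inter (add_right_injective v),
      Set.image_inter (add_right_injective v)]
    have himg (S : Set V) : (fun y => v + y) '' S = (fun y => -v + y) ⁻¹' S := by simp
    congr 3 <;> rw [himg] <;> ext x <;> simp [hv]
    constructor <;> intro _ <;> linarith

end Grid

/-! ### Extending a valuation by zero -/

section Extend

variable {V : Type*} [NormedAddCommGroup V] [NormedSpace ℝ V]

open Classical in
/-- The extension by zero of a functional on convex bodies to all sets. -/
def extendZero (φ : ConvexBody V → ℝ) (A : Set V) : ℝ :=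
  if h : Convex ℝ A ∧ IsCompact A ∧ A.Nonempty then φ ⟨A, h.1, h.2.1, h.2.2⟩ else 0

theorem extendZero_coe (φ : ConvexBody V → ℝ) (K : ConvexBody V) :
    extendZero φ K = φ K :=
  dif_pos ⟨K.convex, K.isCompact, K.nonempty⟩

theorem extendZero_empty (φ : ConvexBody V → ℝ) : extendZero φ ∅ = 0 :=
  dif_neg fun h => Set.not_nonempty_empty h.2.2

theorem abs_extendZero_le {φ : ConvexBody V → ℝ} {A : Set V} {M : ℝ} (hM : 0 ≤ M)
    (h : ∀ K : ConvexBody V, (K : Set V) = A → |φ K| ≤ M) : |extendZero φ A| ≤ M := by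
  by_cases hA : Convex ℝ A ∧ IsCompact A ∧ A.Nonempty
  · rw [extendZero, dif_pos hA]
    exact h _ rfl
  · rwa [extendZero, dif_neg hA, abs_zero]

theorem extendZero_translate {φ : ConvexBody V → ℝ} (hφ : IsTranslationInvariant φ) (v : V)
    (A : Set V) : extendZero φ ((fun y => v + y) '' A) = extendZero φ A := by
  have fwd {A : Set V} (v : V) (hA : Convex ℝ A ∧ IsCompact A ∧ A.Nonempty) :
      extendZero φ ((fun y => v + y) '' A) = extendZero φ A := by
    let K : ConvexBody V := ⟨A, hA.1, hA.2.1, hA.2.2⟩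
    exact (extendZero_coe φ (K.translate v)).trans ((hφ K v).trans (extendZero_coe φ K).symm)
  by_cases hA : Convex ℝ A ∧ IsCompact A ∧ A.Nonempty
  · exact fwd v hA
  by_cases hB : Convex ℝ ((fun y => v + y) '' A) ∧ IsCompact ((fun y => v + y) '' A) ∧
      ((fun y => v + y) '' A).Nonempty
  · refine (fwd (-v) hB).symm.trans ?_
    rw [Set.image_image]
    simp only [neg_add_cancel_left, Set.image_id']
  · rw [extendZero, extendZero, dif_neg hA, dif_neg hB]

theorem isCutAdditive_extendZero {φ : ConvexBody V → ℝ} (hφ : IsValuation φ) :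
    IsCutAdditive (extendZero φ) := by
  refine ⟨extendZero_empty φ, fun A hA hA' f a => ?_⟩
  rcases Set.eq_empty_or_nonempty (A ∩ {x | f x ≤ a}) with h₁ | ⟨x, hxA, hx⟩
  · have hlt : ∀ x ∈ A, a < f x := fun x hx => by
      by_contra! h
      exact (Set.eq_empty_iff_forall_notMem.1 h₁ x) ⟨hx, h⟩
    have h₂ : A ∩ {x | f x = a} = ∅ :=
      Set.eq_empty_of_forall_notMem fun x hx => (hlt x hx.1).ne' hx.2
    have h₃ : A ∩ {x | a ≤ f x} = A := Set.inter_eq_left.2 fun x hx => (hlt x hx).le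
    rw [h₁, h₂, h₃, add_comm]
  rcases Set.eq_empty_or_nonempty (A ∩ {x | a ≤ f x}) with h₁ | ⟨y, hyA, hy⟩
  · have hlt : ∀ x ∈ A, f x < a := fun x hx => by
      by_contra! h
      exact (Set.eq_empty_iff_forall_notMem.1 h₁ x) ⟨hx, h⟩
    have h₂ : A ∩ {x | f x = a} = ∅ :=
      Set.eq_empty_of_forall_notMem fun x hx => (hlt x hx.1).ne hx.2
    have h₃ : A ∩ {x | f x ≤ a} = A := Set.inter_eq_left.2 fun x hx => (hlt x hx).le
    rw [h₁, h₂, h₃]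
  obtain ⟨w, hwA, hw⟩ := hA.isPreconnected.intermediate_value hxA hyA f.continuous.continuousOn
    ⟨hx, hy⟩
  let K : ConvexBody V := ⟨A ∩ {x | f x ≤ a},
    hA.inter ((convex_Iic a).linear_preimage (f : V →ₗ[ℝ] ℝ)),
    hA'.inter_right ((isClosed_Iic (a := a)).preimage f.continuous), ⟨x, hxA, hx⟩⟩
  let L : ConvexBody V := ⟨A ∩ {x | a ≤ f x},
    hA.inter ((convex_Ici a).linear_preimage (f : V →ₗ[ℝ] ℝ)),
    hA'.inter_right ((isClosed_Ici (a := a)).preimage f.continuous), ⟨y, hyA, hy⟩⟩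
  have hU : (K : Set V) ∪ L = A := by
    change A ∩ {x | f x ≤ a} ∪ A ∩ {x | a ≤ f x} = A
    rw [← Set.inter_union_distrib_left]
    exact Set.inter_eq_left.2 fun x _ => le_total (f x) a
  have hI : (K : Set V) ∩ L = A ∩ {x | f x = a} := by
    change (A ∩ {x | f x ≤ a}) ∩ (A ∩ {x | a ≤ f x}) = _
    rw [← Set.inter_inter_distrib_left]
    congr 1
    ext x
    exact (le_antisymm_iff (a := f x)).symm
  have h := hφ K L (by rwa [hU]) (by rw [hI]; exact ⟨w, hwA, hw⟩)
  simp only [← extendZero_coe φ] at h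
  rw [← hI]
  exact (congrArg (fun S => extendZero φ S + extendZero φ ((K : Set V) ∩ L)) hU).symm.trans h

end Extend

/-! ### The grid of a basis -/

theorem IsPreconnected.inter_frontier_nonempty_of_not_subset {X : Type*} [TopologicalSpace X]
    {C A : Set X} (hC : IsPreconnected C) (h₁ : (C ∩ A).Nonempty) (h₂ : ¬C ⊆ A) :
    (C ∩ frontier A).Nonempty := by
  by_contra h
  rw [Set.not_nonempty_iff_eq_empty, Set.eq_empty_iff_forall_notMem] at h
  have hint : ∀ x ∈ C, x ∈ closure A → x ∈ interior A := fun x hx hxA => by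
    by_contra hi
    exact h x ⟨hx, hxA, hi⟩
  obtain ⟨x, hxC, hxA⟩ := h₁
  obtain ⟨y, hyC, hyA⟩ := Set.not_subset.1 h₂
  obtain ⟨w, _, hw, hw'⟩ := hC (interior A) (closure A)ᶜ isOpen_interior
    isClosed_closure.isOpen_compl
    (fun x hx => by
      by_cases hxA : x ∈ closure A
      · exact Or.inl (hint x hx hxA)
      · exact Or.inr hxA)
    ⟨x, hxC, hint x hxC (subset_closure hxA)⟩
    ⟨y, hyC, fun hy => hyA (interior_subset (hint y hyC hy))⟩
  exact hw' (interior_subset_closure hw)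

section Basis

variable {V : Type*} [NormedAddCommGroup V] [NormedSpace ℝ V] [FiniteDimensional ℝ V] {n : ℕ}

/-- The coordinate functionals of a basis, as continuous linear maps. -/
def coordCLM (b : Basis (Fin n) ℝ V) (i : Fin n) : V →L[ℝ] ℝ :=
  LinearMap.toContinuousLinearMap (b.coord i)

/-- The point with integer coordinates `z`. -/
def latticePoint (b : Basis (Fin n) ℝ V) (z : Fin n → ℤ) : V :=
  b.equivFun.symm fun i => (z i : ℝ)

theorem coordCLM_latticePoint (b : Basis (Fin n) ℝ V) (z : Fin n → ℤ) (i : Fin n) :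
    coordCLM b i (latticePoint b z) = z i := by
  change b.repr (b.equivFun.symm _) i = _
  rw [← Basis.equivFun_apply, LinearEquiv.apply_symm_apply]

theorem isCompact_gridCell_zero (b : Basis (Fin n) ℝ V) :
    IsCompact (gridCell (coordCLM b) 0) := by
  have h : gridCell (coordCLM b) 0 =
      b.equivFun.symm '' Set.univ.pi fun _ : Fin n => Set.Icc (0 : ℝ) 1 := by
    ext x
    rw [← b.equivFun.symm.coe_toEquiv, Equiv.image_eq_preimage_symm]
    simp [gridCell, coordCLM, Pi.le_def, forall_and]
  rw [h]
  exact (isCompact_univ_pi fun _ => isCompact_Icc).image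
    (LinearMap.continuous_of_finiteDimensional (b.equivFun.symm : (Fin n → ℝ) →ₗ[ℝ] V))

theorem sub_mem_gridCell_zero {b : Basis (Fin n) ℝ V} {z : Fin n → ℤ} {x : V}
    (hx : x ∈ gridCell (coordCLM b) z) :
    -latticePoint b z + x ∈ gridCell (coordCLM b) 0 := fun i => by
  have := hx i
  simp only [map_add, map_neg, coordCLM_latticePoint, Pi.zero_apply, Int.cast_zero]
  constructor <;> linarith

theorem halfOpenCell_zero (b : Basis (Fin n) ℝ V) :
    halfOpenCell (coordCLM b) 0 = ZSpan.fundamentalDomain b := by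
  ext x
  simp [halfOpenCell, coordCLM, ZSpan.mem_fundamentalDomain]

theorem halfOpenCell_eq_preimage (b : Basis (Fin n) ℝ V) (z : Fin n → ℤ) :
    halfOpenCell (coordCLM b) z =
      (fun y => -latticePoint b z + y) ⁻¹' ZSpan.fundamentalDomain b := by
  rw [← halfOpenCell_zero]
  ext x
  simp only [halfOpenCell, Set.mem_ofPred_eq, Set.mem_preimage, map_add, map_neg,
    coordCLM_latticePoint, Pi.zero_apply, Int.cast_zero, zero_add]
  refine forall_congr' fun i => and_congr ?_ ?_ <;> constructor <;> intro _ <;> linarith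

variable [MeasurableSpace V] [BorelSpace V] (μ : Measure V) [μ.IsAddHaarMeasure]

theorem measure_halfOpenCell (b : Basis (Fin n) ℝ V) (z : Fin n → ℤ) :
    μ (halfOpenCell (coordCLM b) z) = μ (ZSpan.fundamentalDomain b) := by
  rw [halfOpenCell_eq_preimage, measure_preimage_add]

/-- The grid estimate: up to an error controlled by the volume of a neighbourhood of the
boundary, a continuous translation invariant valuation is a multiple of the volume. -/
theorem exists_abs_sub_mul_volume_le (b : Basis (Fin n) ℝ V) {φ : ConvexBody V → ℝ}
    (hφc : Continuous φ) (hφt : IsTranslationInvariant φ) (hφv : IsValuation φ) :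
    ∃ c C R : ℝ, ∀ (K : ConvexBody V) (T : Set V), μ T < ⊤ →
      (∀ y ∈ frontier (K : Set V), ∀ x, dist x y ≤ R → x ∈ T) →
      |φ K - c * μ.real (K : Set V)| ≤ C * μ.real T := by
  obtain ⟨M, hM, hMφ⟩ := ConvexBody.exists_abs_le_of_subset hφc (isCompact_gridCell_zero b)
  obtain ⟨R, hR⟩ := Metric.isBounded_iff.1 (isCompact_gridCell_zero b).isBounded
  set ℓ := coordCLM b
  set ψ := extendZero φ
  set c₀ := cellPart ℓ 0 ψ Set.univ
  set v₀ := μ.real (ZSpan.fundamentalDomain b)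
  have hv₀ : 0 < v₀ := ENNReal.toReal_pos (ZSpan.measure_fundamentalDomain_ne_zero b)
    (ZSpan.fundamentalDomain_isBounded b).measure_lt_top.ne
  have hvol (z) : μ.real (halfOpenCell ℓ z) = v₀ := by
    rw [Measure.real, measure_halfOpenCell]; rfl
  have hcell_fin (z) : μ (halfOpenCell ℓ z) ≠ ⊤ := by
    rw [measure_halfOpenCell]; exact (ZSpan.fundamentalDomain_isBounded b).measure_lt_top.ne
  have hψ : IsCutAdditive ψ := isCutAdditive_extendZero hφv
  have hdiam (z) {x y : V} (hx : x ∈ gridCell ℓ z) (hy : y ∈ gridCell ℓ z) : dist x y ≤ R := by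
    simpa using hR (sub_mem_gridCell_zero hx) (sub_mem_gridCell_zero hy)
  have hbound (z) {B : Set V} (hB : B ⊆ gridCell ℓ z) : |ψ B| ≤ M := by
    refine abs_extendZero_le hM fun K hK => ?_
    rw [← hφt K (-latticePoint b z)]
    refine hMφ _ ?_
    rintro _ ⟨x, hx, rfl⟩
    exact sub_mem_gridCell_zero (hB (hK ▸ hx))
  refine ⟨c₀ / v₀, (2 ^ n * M + |c₀|) / v₀, R, fun K T hT hKT => ?_⟩
  have hcellwise (z) : |cellPart ℓ z ψ K - c₀ / v₀ * μ.real ((K : Set V) ∩ halfOpenCell ℓ z)| ≤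
      (2 ^ n * M + |c₀|) / v₀ * μ.real (T ∩ halfOpenCell ℓ z) := by
    have hnonneg : 0 ≤ (2 ^ n * M + |c₀|) / v₀ * μ.real (T ∩ halfOpenCell ℓ z) := by positivity
    by_cases hdisj : ((gridCell ℓ z) ∩ K).Nonempty
    · by_cases hsub : gridCell ℓ z ⊆ K
      · have h₁ : cellPart ℓ z ψ K = c₀ := by
          rw [cellPart_congr (A' := Set.univ) fun B hB => by
            rw [Set.univ_inter, Set.inter_eq_right.2 (hB.trans hsub)]]
          have := cellPart_translate (coordCLM_latticePoint b z)
            (extendZero_translate hφt (latticePoint b z)) Set.univ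
          rwa [Set.image_univ_of_surjective (add_left_surjective (latticePoint b z))] at this
        rw [h₁, Set.inter_eq_right.2 ((halfOpenCell_subset_gridCell ℓ z).trans hsub), hvol,
          div_mul_cancel₀ _ hv₀.ne', sub_self, abs_zero]
        exact hnonneg
      · obtain ⟨y, hyz, hy⟩ :=
          (convex_gridCell ℓ z).isPreconnected.inter_frontier_nonempty_of_not_subset hdisj hsub
        have hT' : T ∩ halfOpenCell ℓ z = halfOpenCell ℓ z := Set.inter_eq_right.2 fun x hx =>
          hKT y hy x (hdiam z (halfOpenCell_subset_gridCell ℓ z hx) hyz)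
        rw [hT', hvol, div_mul_cancel₀ _ hv₀.ne']
        refine (abs_sub _ _).trans (add_le_add
          (abs_cellPart_le fun B hB => hbound z (Set.inter_subset_right.trans hB)) ?_)
        rw [abs_mul, abs_div, abs_of_pos hv₀, abs_of_nonneg measureReal_nonneg]
        calc |c₀| / v₀ * μ.real ((K : Set V) ∩ halfOpenCell ℓ z) ≤ |c₀| / v₀ * v₀ := by
              gcongr
              rw [← hvol z]
              exact measureReal_mono Set.inter_subset_right (hcell_fin z)
          _ = |c₀| := div_mul_cancel₀ _ hv₀.ne'
    · rw [Set.not_nonempty_iff_eq_empty] at hdisj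
      have hempty {B : Set V} (hB : B ⊆ gridCell ℓ z) : (K : Set V) ∩ B = ∅ :=
        Set.eq_empty_of_forall_notMem fun x hx =>
          Set.eq_empty_iff_forall_notMem.1 hdisj x ⟨hB hx.2, hx.1⟩
      have h₁ : cellPart ℓ z ψ K = 0 := by
        have := abs_cellPart_le (ℓ := ℓ) (z := z) (ψ := ψ) (A := (K : Set V)) (M := 0)
          fun B hB => by rw [hempty hB, hψ.empty, abs_zero]
        simpa using this
      rw [h₁, hempty (halfOpenCell_subset_gridCell ℓ z)]
      simpa using hnonneg
  obtain ⟨N, hN⟩ : ∃ N : ℕ, ∀ i, ∀ x ∈ (K : Set V), |ℓ i x| < N := by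
    have h (i : Fin n) := K.isCompact.exists_bound_of_continuousOn (ℓ i).continuous.continuousOn
    choose B hB using h
    obtain ⟨N, hN⟩ := exists_nat_gt (∑ i, |B i|)
    refine ⟨N, fun i x hx => (hB i x hx).trans_lt (((le_abs_self _).trans ?_).trans_lt hN)⟩
    exact Finset.single_le_sum (f := fun i => |B i|) (fun _ _ => abs_nonneg _) (Finset.mem_univ i)
  have hbox : ∀ i, ∀ x ∈ (K : Set V),
      ((-N : ℤ) : ℝ) ≤ ℓ i x ∧ ℓ i x < (-N : ℤ) + (2 * N : ℕ) := fun i x hx => by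
    have := abs_lt.1 (hN i x hx)
    push_cast
    constructor <;> linarith
  set P := Fintype.piFinset fun _ : Fin n => Finset.Ico (-N : ℤ) (-N + (2 * N : ℕ)) with hP
  have hsum : φ K = ∑ z ∈ P, cellPart ℓ z ψ K := by
    rw [← extendZero_coe φ K]
    exact hψ.sum_cellPart K.convex K.isCompact (2 * N) hbox
  have hcover : (K : Set V) = ⋃ z ∈ P, (K : Set V) ∩ halfOpenCell ℓ z := by
    ext x
    simp only [Set.mem_iUnion, Set.mem_inter_iff, exists_prop]
    refine ⟨fun hx => ⟨fun i => ⌊ℓ i x⌋, ?_, hx, mem_halfOpenCell_iff.2 fun _ => rfl⟩,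
      fun ⟨_, _, hx, _⟩ => hx⟩
    simp only [hP, Fintype.mem_piFinset, Finset.mem_Ico]
    refine fun i => ⟨Int.le_floor.2 (hbox i x hx).1, Int.floor_lt.2 ?_⟩
    have := (hbox i x hx).2
    push_cast at this ⊢
    exact this
  have hvolsum : μ.real (K : Set V) = ∑ z ∈ P, μ.real ((K : Set V) ∩ halfOpenCell ℓ z) := by
    conv_lhs => rw [hcover]
    refine measureReal_biUnion_finset (fun z _ w _ hzw =>
      (pairwise_disjoint_halfOpenCell ℓ hzw).mono Set.inter_subset_right Set.inter_subset_right)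
      (fun z _ => K.isClosed.measurableSet.inter (measurableSet_halfOpenCell ℓ z))
      (fun z _ => measure_ne_top_of_subset Set.inter_subset_right (hcell_fin z))
  have hTsum : ∑ z ∈ P, μ.real (T ∩ halfOpenCell ℓ z) ≤ μ.real T := by
    have h (z) : T ∩ halfOpenCell ℓ z = halfOpenCell ℓ z ∩ T := Set.inter_comm _ _
    simp_rw [h, ← measureReal_restrict_apply (measurableSet_halfOpenCell ℓ _)]
    have : IsFiniteMeasure (μ.restrict T) := ⟨by rwa [Measure.restrict_apply_univ]⟩
    rw [← measureReal_biUnion_finset (fun z _ w _ hzw => pairwise_disjoint_halfOpenCell ℓ hzw)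
      (fun z _ => measurableSet_halfOpenCell ℓ z)]
    refine (measureReal_mono (Set.subset_univ _)).trans_eq ?_
    rw [measureReal_restrict_apply_univ]
  rw [hsum, hvolsum, Finset.mul_sum, ← Finset.sum_sub_distrib]
  calc _ ≤ ∑ z ∈ P, |cellPart ℓ z ψ K - c₀ / v₀ * μ.real ((K : Set V) ∩ halfOpenCell ℓ z)| :=
        Finset.abs_sum_le_sum_abs _ _
    _ ≤ ∑ z ∈ P, (2 ^ n * M + |c₀|) / v₀ * μ.real (T ∩ halfOpenCell ℓ z) :=
        Finset.sum_le_sum fun z _ => hcellwise z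
    _ ≤ _ := by
        rw [← Finset.mul_sum]
        gcongr

end Basis

/-- Hadwiger. Let `V` be an `n`-dimensional real vector space (with a
fixed translation invariant Lebesgue measure `μ`) and let `φ : 𝒦(V) → ℝ` be a
continuous, translation invariant valuation which is homogeneous of degree `n`. Then
`φ = c · vol_n` for some constant `c ∈ ℝ`. -/
theorem hadwiger_top_degree
    {V : Type*} [NormedAddCommGroup V] [NormedSpace ℝ V] [FiniteDimensional ℝ V]
    [MeasurableSpace V] [BorelSpace V] (μ : Measure V) [μ.IsAddHaarMeasure]
    (n : ℕ) (hn : Module.finrank ℝ V = n)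
    (φ : ConvexBody V → ℝ) (hφc : Continuous φ)
    (hφt : IsTranslationInvariant φ) (hφv : IsValuation φ)
    (hhom : ∀ (K : ConvexBody V) (t : ℝ), 0 ≤ t → φ (t • K) = t ^ n * φ K) :
    ∃ c : ℝ, ∀ K : ConvexBody V, φ K = c * (μ (K : Set V)).toReal := by
  obtain ⟨c, C, R, h⟩ :=
    exists_abs_sub_mul_volume_le μ (finBasisOfFinrankEq ℝ V hn) hφc hφt hφv
  refine ⟨c, fun K => ?_⟩
  have : ProperSpace V := FiniteDimensional.proper ℝ V
  set F := frontier (K : Set V)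
  have hF : Bornology.IsBounded F := K.isBounded.subset K.isClosed.frontier_subset
  have hfin (r : ℝ) : μ (Metric.cthickening r F) < ⊤ := hF.cthickening.measure_lt_top
  have hle (m : ℕ) : |φ K - c * μ.real (K : Set V)| ≤
      C * μ.real (Metric.cthickening (R / (m + 1 : ℝ)) F) := by
    set t : ℝ := m + 1
    have ht : 0 < t := by positivity
    have hscale (s : Set V) : μ.real (t • s) = t ^ n * μ.real s := by
      rw [Measure.real, Measure.addHaar_smul, hn, ENNReal.toReal_mul,
        ENNReal.toReal_ofReal (abs_nonneg _), abs_of_pos (by positivity)]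
      rfl
    have key := h (t • K) (t • Metric.cthickening (R / t) F)
      (by rw [Measure.addHaar_smul]; exact ENNReal.mul_lt_top ENNReal.ofReal_lt_top (hfin _)) ?_
    · rw [hhom K t ht.le, ConvexBody.coe_smul, hscale, hscale, mul_left_comm c, ← mul_sub, abs_mul,
        abs_of_pos (by positivity : 0 < t ^ n), mul_left_comm C] at key
      exact le_of_mul_le_mul_left key (by positivity)
    · intro y hy x hxy
      rw [ConvexBody.coe_smul] at hy
      have hy' : t⁻¹ • y ∈ F := by
        rw [← Set.mem_smul_set_iff_inv_smul_mem₀ ht.ne']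
        exact ((Homeomorph.smulOfNeZero t ht.ne').image_frontier (K : Set V)).symm.subset hy
      rw [Set.mem_smul_set_iff_inv_smul_mem₀ ht.ne']
      refine Metric.mem_cthickening_of_dist_le _ _ _ _ hy' ?_
      rw [dist_smul₀, norm_inv, Real.norm_of_nonneg ht.le, inv_mul_eq_div]
      gcongr
  have hlim : Filter.Tendsto (fun m : ℕ => C * μ.real (Metric.cthickening (R / (m + 1 : ℝ)) F))
      Filter.atTop (nhds 0) := by
    have h₁ := tendsto_measure_cthickening_of_isClosed (μ := μ) (s := F)
      ⟨1, one_pos, (hfin 1).ne⟩ isClosed_frontier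
    rw [K.convex.addHaar_frontier μ] at h₁
    have h₂ : Filter.Tendsto (fun m : ℕ => R / (m + 1 : ℝ)) Filter.atTop (nhds 0) := by
      simpa [div_eq_mul_inv] using tendsto_one_div_add_atTop_nhds_zero_nat.const_mul R
    simpa [Measure.real] using
      ((ENNReal.tendsto_toReal ENNReal.zero_ne_top).comp (h₁.comp h₂)).const_mul C
  have hzero : |φ K - c * μ.real (K : Set V)| ≤ 0 := ge_of_tendsto' hlim hle
  exact sub_eq_zero.1 (abs_nonpos_iff.1 hzero)
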